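/- arXiv:1905.11162 — 2 statements merged into one kernel-verified Lean document; each statement's English description precedes it below -/
import Mathlib

section
/- Under the hypotheses of the main theorem, the average ū(x₁) := ⨍_ω u(x₁, x') dx' converges to u^± ∈ {W = 0} as x₁ → ±∞. -/
open MeasureTheory Metric Set Filter Topology
open scoped ENNReal NNReal RealInnerProductSpace

/-- `ω ⊂ ℝ^m` has Lipschitz boundary: near each boundary point, in a suitable orthonormal
splitting of `ℝ^m` into a unit direction `u` and its orthogonal complement, `ω` is the open
hypograph/epigraph of a Lipschitz function. -/
def LipschitzBoundary {m : ℕ} (ω : Set (EuclideanSpace ℝ (Fin m))) : Prop :=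
  ∀ p ∈ frontier ω, ∃ u : EuclideanSpace ℝ (Fin m), ‖u‖ = 1 ∧
    ∃ (φ : EuclideanSpace ℝ (Fin m) → ℝ) (K : ℝ≥0) (r : ℝ), 0 < r ∧ LipschitzWith K φ ∧
      ∀ x ∈ Metric.ball p r, (x ∈ ω ↔ φ (x - ⟪x, u⟫ • u) < ⟪x, u⟫)

/-- Membership in `H¹(ω, ℝ^N)` (encoded for an everywhere-defined representative via
differentiability on `ω` together with integrability of the map and of `|∇v|²`). -/
def MemH1 {m N : ℕ} (ω : Set (EuclideanSpace ℝ (Fin m)))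
    (v : EuclideanSpace ℝ (Fin m) → EuclideanSpace ℝ (Fin N)) : Prop :=
  DifferentiableOn ℝ v ω ∧ MeasureTheory.IntegrableOn v ω ∧
    (∫⁻ x in ω, (‖fderivWithin ℝ v ω x‖₊ : ℝ≥0∞) ^ 2) < ⊤

/-- The averaged energy `e(v) = ⨍_ω (|∇v|² + W(v))`. -/
noncomputable def eAvg {m N : ℕ} (W : EuclideanSpace ℝ (Fin N) → ℝ≥0∞)
    (ω : Set (EuclideanSpace ℝ (Fin m)))
    (v : EuclideanSpace ℝ (Fin m) → EuclideanSpace ℝ (Fin N)) : ℝ≥0∞ :=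
  (volume ω)⁻¹ * ∫⁻ x in ω, ((‖fderivWithin ℝ v ω x‖₊ : ℝ≥0∞) ^ 2 + W (v x))

/-- The averaged potential
`V(z) = inf { ⨍_ω (|∇v|² + W(v)) : v ∈ H¹(ω,ℝ^N), ⨍_ω v = z }`. -/
noncomputable def Vavg {m N : ℕ} (W : EuclideanSpace ℝ (Fin N) → ℝ≥0∞)
    (ω : Set (EuclideanSpace ℝ (Fin m))) (z : EuclideanSpace ℝ (Fin N)) : ℝ≥0∞ :=
  ⨅ v ∈ {v : EuclideanSpace ℝ (Fin m) → EuclideanSpace ℝ (Fin N) |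
      MemH1 ω v ∧ (⨍ x in ω, v x) = z}, eAvg W ω v

section helpers
variable {m N : ℕ}

def PNice (ω : Set (EuclideanSpace ℝ (Fin m)))
    (v : EuclideanSpace ℝ (Fin m) → EuclideanSpace ℝ (Fin N)) : Prop :=
  Measurable v ∧ DifferentiableOn ℝ v ω

noncomputable def gradE (ω : Set (EuclideanSpace ℝ (Fin m)))
    (v : EuclideanSpace ℝ (Fin m) → EuclideanSpace ℝ (Fin N)) : ℝ≥0∞ :=
  ∫⁻ x in ω, ‖fderiv ℝ v x‖ₑ

lemma pointwise_seg {ω : Set (EuclideanSpace ℝ (Fin m))} (hωo : IsOpen ω)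
    {v : EuclideanSpace ℝ (Fin m) → EuclideanSpace ℝ (Fin N)} (hv : PNice ω v)
    (x h : EuclideanSpace ℝ (Fin m)) (hx : ∀ s ∈ Icc (0:ℝ) 1, x + s • h ∈ ω) :
    ‖v (x + h) - v x‖ₑ ≤ ∫⁻ s in Icc (0:ℝ) 1, ‖fderiv ℝ v (x + s • h)‖ₑ * ‖h‖ₑ := by
  by_cases hfin : ∫⁻ s in Icc (0:ℝ) 1, ‖fderiv ℝ v (x + s • h)‖ₑ * ‖h‖ₑ = ⊤
  · rw [hfin]; exact le_top
  have hder : ∀ s ∈ Icc (0:ℝ) 1,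
      HasDerivAt (fun s : ℝ => v (x + s • h)) (fderiv ℝ v (x + s • h) h) s := by
    intro s hs
    have h1 : HasFDerivAt v (fderiv ℝ v (x + s • h)) (x + s • h) :=
      ((hv.2 _ (hx s hs)).differentiableAt (hωo.mem_nhds (hx s hs))).hasFDerivAt
    have h2 : HasDerivAt (fun s : ℝ => x + s • h) h s := by
      simpa using ((hasDerivAt_id s).smul_const h).const_add x
    exact h1.comp_hasDerivAt s h2
  have hmeas : Measurable (fun s : ℝ => fderiv ℝ v (x + s • h) h) :=
    (measurable_fderiv_apply_const ℝ v h).comp (by fun_prop)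
  have hle : ∀ s : ℝ, ‖fderiv ℝ v (x + s • h) h‖ₑ ≤ ‖fderiv ℝ v (x + s • h)‖ₑ * ‖h‖ₑ :=
    fun s => ContinuousLinearMap.le_opENorm _ _
  have hint : IntervalIntegrable (fun s : ℝ => fderiv ℝ v (x + s • h) h) volume 0 1 := by
    rw [intervalIntegrable_iff_integrableOn_Icc_of_le zero_le_one]
    refine ⟨hmeas.aestronglyMeasurable, ?_⟩
    exact lt_of_le_of_lt (lintegral_mono hle) (lt_top_iff_ne_top.2 hfin)
  have key := intervalIntegral.integral_eq_sub_of_hasDerivAt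
    (by rw [uIcc_of_le zero_le_one]; exact hder) hint
  simp only [one_smul, zero_smul, add_zero] at key
  rw [← key, intervalIntegral.integral_of_le zero_le_one]
  refine (enorm_integral_le_lintegral_enorm _).trans ?_
  refine (lintegral_mono hle).trans ?_
  exact lintegral_mono_set Ioc_subset_Icc_self

lemma translate_est {ω : Set (EuclideanSpace ℝ (Fin m))} (hωo : IsOpen ω)
    {v : EuclideanSpace ℝ (Fin m) → EuclideanSpace ℝ (Fin N)} (hv : PNice ω v)
    (h : EuclideanSpace ℝ (Fin m)) {S : Set (EuclideanSpace ℝ (Fin m))} (hS : MeasurableSet S)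
    (hx : ∀ x ∈ S, ∀ s ∈ Icc (0:ℝ) 1, x + s • h ∈ ω) :
    ∫⁻ x in S, ‖v (x + h) - v x‖ₑ ≤ ‖h‖ₑ * gradE ω v := by
  have hG : Measurable (fun x => ‖fderiv ℝ v x‖ₑ) := (measurable_fderiv ℝ v).enorm
  calc ∫⁻ x in S, ‖v (x + h) - v x‖ₑ
      ≤ ∫⁻ x in S, ∫⁻ s in Icc (0:ℝ) 1, ‖fderiv ℝ v (x + s • h)‖ₑ * ‖h‖ₑ :=
        setLIntegral_mono' hS fun x hxS => pointwise_seg hωo hv x h (hx x hxS)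
    _ = ∫⁻ s in Icc (0:ℝ) 1, ∫⁻ x in S, ‖fderiv ℝ v (x + s • h)‖ₑ * ‖h‖ₑ := by
        apply lintegral_lintegral_swap
        apply Measurable.aemeasurable
        apply Measurable.mul_const
        exact hG.comp (f := fun p : EuclideanSpace ℝ (Fin m) × ℝ => p.1 + p.2 • h) (by fun_prop)
    _ ≤ ∫⁻ s in Icc (0:ℝ) 1, ‖h‖ₑ * gradE ω v := by
        refine setLIntegral_mono' measurableSet_Icc fun s hs => ?_
        have hGs : Measurable (fun x => ‖fderiv ℝ v (x + s • h)‖ₑ) :=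
          hG.comp (f := fun x : EuclideanSpace ℝ (Fin m) => x + s • h) (by fun_prop)
        rw [lintegral_mul_const _ hGs, mul_comm]
        gcongr
        unfold gradE
        have hmp : MeasurePreserving (fun x : EuclideanSpace ℝ (Fin m) => x + s • h)
          volume volume := measurePreserving_add_right volume (s • h)
        rw [← hmp.setLIntegral_comp_preimage hωo.measurableSet hG]
        exact lintegral_mono_set fun x hxS => hx x hxS s hs
    _ = ‖h‖ₑ * gradE ω v := by simp

def Good (N : ℕ) (ω B S : Set (EuclideanSpace ℝ (Fin m))) : Prop :=
  ∃ C : ℝ≥0, ∀ v : EuclideanSpace ℝ (Fin m) → EuclideanSpace ℝ (Fin N), PNice ω v →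
    ∀ c, ∫⁻ x in S, ‖v x - c‖ₑ ≤ C * (gradE ω v + ∫⁻ x in B, ‖v x - c‖ₑ)

lemma Good.mono {ω B S T : Set (EuclideanSpace ℝ (Fin m))} (h : Good N ω B T) (hST : S ⊆ T) :
    Good N ω B S := by
  obtain ⟨C, hC⟩ := h
  exact ⟨C, fun v hv c => (lintegral_mono_set hST).trans (hC v hv c)⟩

lemma Good.union {ω B S T : Set (EuclideanSpace ℝ (Fin m))} (h : Good N ω B S)
    (h' : Good N ω B T) : Good N ω B (S ∪ T) := by
  obtain ⟨C, hC⟩ := h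
  obtain ⟨D, hD⟩ := h'
  refine ⟨C + D, fun v hv c => (lintegral_union_le _ _ _).trans ?_⟩
  rw [ENNReal.coe_add, add_mul]
  exact add_le_add (hC v hv c) (hD v hv c)

lemma good_empty (ω B : Set (EuclideanSpace ℝ (Fin m))) : Good N ω B ∅ :=
  ⟨0, fun v hv c => by simp⟩

lemma Good.translate {ω B S T : Set (EuclideanSpace ℝ (Fin m))} (hωo : IsOpen ω)
    (hT : Good N ω B T) (hTm : MeasurableSet T) (hS : MeasurableSet S)
    (h : EuclideanSpace ℝ (Fin m))
    (hx : ∀ x ∈ S, ∀ s ∈ Icc (0:ℝ) 1, x + s • h ∈ ω) (hST : ∀ x ∈ S, x + h ∈ T) :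
    Good N ω B S := by
  obtain ⟨C, hC⟩ := hT
  refine ⟨‖h‖₊ + C, fun v hv c => ?_⟩
  have hvm := hv.1
  calc ∫⁻ x in S, ‖v x - c‖ₑ
      ≤ ∫⁻ x in S, (‖v (x + h) - v x‖ₑ + ‖v (x + h) - c‖ₑ) := by
        refine lintegral_mono fun x => ?_
        have : v x - c = (v (x + h) - c) - (v (x + h) - v x) := by abel
        rw [this]
        refine (enorm_sub_le (E := EuclideanSpace ℝ (Fin N))).trans ?_
        exact (add_comm _ _).le
    _ = (∫⁻ x in S, ‖v (x + h) - v x‖ₑ) + ∫⁻ x in S, ‖v (x + h) - c‖ₑ :=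
        lintegral_add_left (by fun_prop) _
    _ ≤ ‖h‖ₑ * gradE ω v + C * (gradE ω v + ∫⁻ x in B, ‖v x - c‖ₑ) := by
        gcongr
        · exact translate_est hωo hv h hS hx
        · refine le_trans ?_ (hC v hv c)
          have hmp : MeasurePreserving (fun x : EuclideanSpace ℝ (Fin m) => x + h)
            volume volume := measurePreserving_add_right volume h
          rw [← hmp.setLIntegral_comp_preimage hTm (f := fun x => ‖v x - c‖ₑ) (by fun_prop)]
          exact lintegral_mono_set fun x hxS => hST x hxS
    _ ≤ _ := by
        rw [ENNReal.coe_add, add_mul]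
        gcongr
        · exact le_rfl
        · exact le_self_add

lemma good_interior {ω : Set (EuclideanSpace ℝ (Fin m))} (hωo : IsOpen ω)
    (hωc : IsConnected ω) {x₀ : EuclideanSpace ℝ (Fin m)} (hx₀ : x₀ ∈ ω) {r₀ : ℝ} (hr₀ : 0 < r₀) :
    ∀ x ∈ ω, ∃ ρ > 0, Good N ω (ball x₀ r₀) (ball x ρ) := by
  have hsub : ω ⊆ {x | ∃ ρ > 0, Good N ω (ball x₀ r₀) (ball x ρ)} := by
    refine hωc.isPreconnected.subset_of_closure_inter_subset ?_ ⟨x₀, hx₀, r₀, hr₀, 1, ?_⟩ ?_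
    · rw [Metric.isOpen_iff]
      rintro x ⟨ρ, hρ, hg⟩
      refine ⟨ρ, hρ, fun y hy => ⟨ρ - dist y x, by simpa using hy, hg.mono ?_⟩⟩
      exact ball_subset_ball' (by linarith)
    · intro v hv c; simp
    · rintro x ⟨hxc, hxω⟩
      obtain ⟨δ, hδ, hball⟩ := Metric.isOpen_iff.1 hωo x hxω
      obtain ⟨y, ⟨ρ, hρ, hg⟩, hy⟩ := Metric.mem_closure_iff.1 hxc (δ / 2) (by positivity)
      refine ⟨min ρ (δ / 2), by positivity, ?_⟩
      refine Good.translate hωo hg measurableSet_ball measurableSet_ball (y - x) ?_ ?_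
      · intro z hz s hs
        apply hball
        rw [mem_ball, dist_eq_norm] at hz ⊢
        have h1 : ‖z - x‖ < δ / 2 := hz.trans_le (min_le_right _ _)
        have h2 : ‖s • (y - x)‖ ≤ ‖y - x‖ := by
          rw [norm_smul, Real.norm_of_nonneg hs.1]
          exact mul_le_of_le_one_left (norm_nonneg _) hs.2
        rw [dist_comm, dist_eq_norm] at hy
        have h3 : z + s • (y - x) - x = (z - x) + s • (y - x) := by abel
        rw [h3]
        linarith [norm_add_le (z - x) (s • (y - x))]
      · intro z hz
        rw [mem_ball, dist_eq_norm] at hz ⊢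
        have h3 : z + (y - x) - y = z - x := by abel
        rw [h3]
        exact hz.trans_le (min_le_left _ _)
  exact hsub

lemma good_compact {ω : Set (EuclideanSpace ℝ (Fin m))} (hωo : IsOpen ω)
    (hωc : IsConnected ω) {x₀ : EuclideanSpace ℝ (Fin m)} (hx₀ : x₀ ∈ ω) {r₀ : ℝ} (hr₀ : 0 < r₀)
    {K : Set (EuclideanSpace ℝ (Fin m))} (hK : IsCompact K) (hKω : K ⊆ ω) :
    Good N ω (ball x₀ r₀) K := by
  refine hK.induction_on (p := Good N ω (ball x₀ r₀)) (good_empty _ _)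
    (fun s t hst ht => ht.mono hst) (fun s t hs ht => hs.union ht) ?_
  intro x hx
  obtain ⟨ρ, hρ, hg⟩ := good_interior (N := N) hωo hωc hx₀ hr₀ x (hKω hx)
  exact ⟨ball x ρ, mem_nhdsWithin_of_mem_nhds (ball_mem_nhds x hρ), hg⟩

lemma good_all {ω : Set (EuclideanSpace ℝ (Fin m))} (hωo : IsOpen ω)
    (hωc : IsConnected ω) (hωb : Bornology.IsBounded ω) (hωl : LipschitzBoundary ω)
    {x₀ : EuclideanSpace ℝ (Fin m)} (hx₀ : x₀ ∈ ω) {r₀ : ℝ} (hr₀ : 0 < r₀) :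
    Good N ω (ball x₀ r₀) ω := by
  have hcl : IsCompact (closure ω) := hωb.isCompact_closure
  have : Good N ω (ball x₀ r₀) (closure ω ∩ ω) := by
    refine hcl.induction_on (p := fun S => Good N ω (ball x₀ r₀) (S ∩ ω))
      (by simpa using good_empty _ _)
      (fun s t hst ht => ht.mono (inter_subset_inter_left _ hst))
      (fun s t hs ht => by rw [union_inter_distrib_right]; exact hs.union ht) ?_
    intro p hp
    by_cases hpω : p ∈ ω
    · obtain ⟨ρ, hρ, hg⟩ := good_interior (N := N) hωo hωc hx₀ hr₀ p hpω
      exact ⟨ball p ρ, mem_nhdsWithin_of_mem_nhds (ball_mem_nhds p hρ), hg.mono inter_subset_left⟩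
    have hpf : p ∈ frontier ω := by
      rw [hωo.frontier_eq]; exact ⟨hp, hpω⟩
    obtain ⟨e, he, φ, K, r, hr, hφ, hloc⟩ := hωl p hpf
    refine ⟨ball p (r / 4), mem_nhdsWithin_of_mem_nhds (ball_mem_nhds p (by positivity)), ?_⟩
    have hproj : ∀ (x : EuclideanSpace ℝ (Fin m)) (a : ℝ),
        (x + a • e) - ⟪x + a • e, e⟫ • e = x - ⟪x, e⟫ • e := by
      intro x a
      rw [inner_add_left, real_inner_smul_left, real_inner_self_eq_norm_sq, he, add_smul]
      simp
    have hin : ∀ (x : EuclideanSpace ℝ (Fin m)) (a : ℝ),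
        ⟪x + a • e, e⟫ = ⟪x, e⟫ + a := by
      intro x a
      rw [inner_add_left, real_inner_smul_left, real_inner_self_eq_norm_sq, he]
      simp
    have hball : ∀ (x : EuclideanSpace ℝ (Fin m)) (a : ℝ), x ∈ closedBall p (r / 4) → 0 ≤ a →
        a ≤ r / 2 → x + a • e ∈ ball p r := by
      intro x a hx ha ha'
      rw [mem_closedBall, dist_eq_norm] at hx
      rw [mem_ball, dist_eq_norm]
      have h3 : x + a • e - p = (x - p) + a • e := by abel
      have h4 : ‖a • e‖ = a := by rw [norm_smul, he, Real.norm_of_nonneg ha, mul_one]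
      rw [h3]
      linarith [norm_add_le (x - p) (a • e)]
    set A := ball p (r / 4) ∩ ω with hA
    have hAc : IsCompact (closure A) :=
      hcl.of_isClosed_subset isClosed_closure (closure_mono inter_subset_right)
    have hAcb : closure A ⊆ closedBall p (r / 4) :=
      closure_minimal (inter_subset_left.trans ball_subset_closedBall) isClosed_closedBall
    have hAle : ∀ x ∈ closure A, φ (x - ⟪x, e⟫ • e) ≤ ⟪x, e⟫ := by
      have hcls : IsClosed {x | φ (x - ⟪x, e⟫ • e) ≤ ⟪x, e⟫} :=
        isClosed_le (hφ.continuous.comp (by fun_prop)) (by fun_prop)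
      refine closure_minimal ?_ hcls
      intro x hx
      exact ((hloc x (ball_subset_ball (by linarith) hx.1)).1 hx.2).le
    have hK : IsCompact ((fun x => x + (r / 2) • e) '' closure A) := hAc.image (by fun_prop)
    refine Good.translate hωo (good_compact (N := N) hωo hωc hx₀ hr₀ hK ?_) hK.measurableSet
      (measurableSet_ball.inter hωo.measurableSet) ((r / 2) • e) ?_ ?_
    · rintro _ ⟨x, hx, rfl⟩
      have hb := hball x (r / 2) (hAcb hx) (by positivity) le_rfl
      refine (hloc _ hb).2 ?_
      rw [hproj, hin]
      linarith [hAle x hx]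
    · intro x hx s hs
      rw [smul_smul]
      have hb := hball x (s * (r / 2)) (hAcb (subset_closure hx))
        (mul_nonneg hs.1 (by positivity)) (mul_le_of_le_one_left (by positivity) hs.2)
      refine (hloc _ hb).2 ?_
      rw [hproj, hin]
      have h1 := (hloc x (ball_subset_ball (by linarith) hx.1)).1 hx.2
      have h2 : 0 ≤ s * (r / 2) := mul_nonneg hs.1 (by positivity)
      linarith
    · intro x hx
      exact ⟨x, subset_closure hx, rfl⟩
  exact this.mono fun x hx => ⟨subset_closure hx, hx⟩

lemma base_ball {ω : Set (EuclideanSpace ℝ (Fin m))} (hωo : IsOpen ω)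
    {x₀ : EuclideanSpace ℝ (Fin m)} {δ : ℝ} (hδ : 0 < δ) (hb : ball x₀ (3 * δ) ⊆ ω) :
    ∃ C : ℝ≥0, ∀ v : EuclideanSpace ℝ (Fin m) → EuclideanSpace ℝ (Fin N), PNice ω v →
      ∃ c, ∫⁻ x in ball x₀ δ, ‖v x - c‖ₑ ≤ C * gradE ω v := by
  set B := ball x₀ δ with hB
  have hB0 : volume B ≠ 0 := (measure_ball_pos volume x₀ hδ).ne'
  have hBt : volume B ≠ ⊤ := measure_ball_lt_top.ne
  set B2 := ball (0 : EuclideanSpace ℝ (Fin m)) (2 * δ) with hB2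
  have hB2t : volume B2 ≠ ⊤ := measure_ball_lt_top.ne
  have hCt : (volume B)⁻¹ * (ENNReal.ofReal (2 * δ) * volume B2) ≠ ⊤ :=
    ENNReal.mul_ne_top (ENNReal.inv_ne_top.2 hB0) (ENNReal.mul_ne_top ENNReal.ofReal_ne_top hB2t)
  refine ⟨((volume B)⁻¹ * (ENNReal.ofReal (2 * δ) * volume B2)).toNNReal, fun v hv => ?_⟩
  rw [ENNReal.coe_toNNReal hCt]
  have hvm := hv.1
  have hD : ∫⁻ y in B, ∫⁻ x in B, ‖v x - v y‖ₑ ≤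
      ENNReal.ofReal (2 * δ) * volume B2 * gradE ω v := by
    calc ∫⁻ y in B, ∫⁻ x in B, ‖v x - v y‖ₑ
        ≤ ∫⁻ y in B, ∫⁻ h in B2, ‖v (y + h) - v y‖ₑ := by
          refine setLIntegral_mono' measurableSet_ball fun y hy => ?_
          have hmp : MeasurePreserving (fun h : EuclideanSpace ℝ (Fin m) => y + h)
            volume volume := measurePreserving_add_left volume y
          rw [← hmp.setLIntegral_comp_preimage measurableSet_ball
            (f := fun x => ‖v x - v y‖ₑ) (by fun_prop)]
          refine lintegral_mono_set fun h hh => ?_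
          rw [mem_preimage, mem_ball, dist_eq_norm] at hh
          rw [mem_ball, dist_eq_norm] at hy
          rw [hB2, mem_ball_zero_iff]
          have : h = (y + h - x₀) - (y - x₀) := by abel
          rw [this]
          linarith [norm_sub_le (y + h - x₀) (y - x₀)]
      _ = ∫⁻ h in B2, ∫⁻ y in B, ‖v (y + h) - v y‖ₑ := by
          apply lintegral_lintegral_swap
          apply Measurable.aemeasurable
          simp only [Function.uncurry_def]
          fun_prop
      _ ≤ ∫⁻ h in B2, ENNReal.ofReal (2 * δ) * gradE ω v := by
          refine setLIntegral_mono' measurableSet_ball fun h hh => ?_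
          rw [hB2, mem_ball_zero_iff] at hh
          refine (translate_est hωo hv h measurableSet_ball ?_).trans ?_
          · intro x hx s hs
            apply hb
            rw [mem_ball, dist_eq_norm] at hx ⊢
            have h2 : ‖s • h‖ ≤ ‖h‖ := by
              rw [norm_smul, Real.norm_of_nonneg hs.1]
              exact mul_le_of_le_one_left (norm_nonneg _) hs.2
            have h3 : x + s • h - x₀ = (x - x₀) + s • h := by abel
            rw [h3]
            linarith [norm_add_le (x - x₀) (s • h)]
          · gcongr
            rw [← ofReal_norm]
            exact ENNReal.ofReal_le_ofReal hh.le
      _ = _ := by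
          rw [setLIntegral_const]; ring
  have hmeas : Measurable (fun y => ∫⁻ x in B, ‖v x - v y‖ₑ) := by
    apply Measurable.lintegral_prod_right' (ν := volume.restrict B)
      (f := fun p : EuclideanSpace ℝ (Fin m) × EuclideanSpace ℝ (Fin m) => ‖v p.2 - v p.1‖ₑ)
    fun_prop
  have : IsFiniteMeasure (volume.restrict B) := ⟨by simpa using measure_ball_lt_top⟩
  obtain ⟨y, hy⟩ := exists_le_laverage (μ := volume.restrict B)
    (by rwa [Ne, Measure.restrict_eq_zero]) hmeas.aemeasurable
  refine ⟨v y, hy.trans ?_⟩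
  rw [setLAverage_eq, ENNReal.div_eq_inv_mul, mul_assoc]
  gcongr

lemma poincare {ω : Set (EuclideanSpace ℝ (Fin m))} (hωo : IsOpen ω)
    (hωc : IsConnected ω) (hωb : Bornology.IsBounded ω) (hωl : LipschitzBoundary ω) :
    ∃ C : ℝ≥0, ∀ v : EuclideanSpace ℝ (Fin m) → EuclideanSpace ℝ (Fin N), PNice ω v →
      ∃ c, ∫⁻ x in ω, ‖v x - c‖ₑ ≤ C * gradE ω v := by
  obtain ⟨x₀, hx₀⟩ := hωc.nonempty
  obtain ⟨δ, hδ, hb⟩ := Metric.isOpen_iff.1 hωo x₀ hx₀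
  obtain ⟨C₀, hC₀⟩ := base_ball (N := N) hωo (x₀ := x₀) (δ := δ / 3) (by positivity)
    (by rwa [mul_div_cancel₀ _ (by norm_num)])
  obtain ⟨C, hC⟩ := good_all (N := N) hωo hωc hωb hωl hx₀ (r₀ := δ / 3) (by positivity)
  refine ⟨C * (1 + C₀), fun v hv => ?_⟩
  obtain ⟨c, hc⟩ := hC₀ v hv
  refine ⟨c, (hC v hv c).trans ?_⟩
  calc (C : ℝ≥0∞) * (gradE ω v + ∫⁻ x in ball x₀ (δ / 3), ‖v x - c‖ₑ)
      ≤ C * (gradE ω v + C₀ * gradE ω v) := by gcongr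
    _ = _ := by push_cast; ring


lemma W_pos_away {W : EuclideanSpace ℝ (Fin N) → ℝ≥0∞} (hlsc : LowerSemicontinuous W)
    (hH2 : ∃ c : ℝ≥0∞, 0 < c ∧ ∃ R : ℝ, ∀ z : EuclideanSpace ℝ (Fin N), R ≤ ‖z‖ → c ≤ W z)
    {ε : ℝ} (hε : 0 < ε) :
    ∃ κ : ℝ≥0∞, 0 < κ ∧ ∀ z, (∀ w, W w = 0 → ε ≤ dist z w) → κ ≤ W z := by
  obtain ⟨c, hc, R, hR⟩ := hH2
  set K : Set (EuclideanSpace ℝ (Fin N)) :=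
    closedBall 0 R ∩ {z | ∀ w, W w = 0 → ε ≤ dist z w} with hK
  have hKc : IsCompact K := by
    refine (isCompact_closedBall 0 R).inter_right ?_
    simp only [ofPred_forall]
    refine isClosed_iInter fun w => isClosed_iInter fun _ => ?_
    exact isClosed_le continuous_const (by fun_prop)
  have hout : ∀ z, z ∉ closedBall (0 : EuclideanSpace ℝ (Fin N)) R → c ≤ W z := by
    intro z hz
    rw [mem_closedBall_zero_iff, not_le] at hz
    exact hR z hz.le
  rcases K.eq_empty_or_nonempty with hKe | hKne
  · refine ⟨c, hc, fun z hz => hout z fun hzb => ?_⟩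
    have : z ∈ K := ⟨hzb, hz⟩
    rw [hKe] at this
    exact this
  · obtain ⟨a, haK, ha⟩ := (hlsc.lowerSemicontinuousOn K).exists_isMinOn hKne hKc
    have haW : 0 < W a := by
      rw [pos_iff_ne_zero]
      intro h0
      have := haK.2 a h0
      rw [dist_self] at this
      linarith
    refine ⟨min c (W a), lt_min hc haW, fun z hz => ?_⟩
    by_cases hzb : z ∈ closedBall (0 : EuclideanSpace ℝ (Fin N)) R
    · exact (min_le_right _ _).trans (ha ⟨hzb, hz⟩)
    · exact (min_le_left _ _).trans (hout z hzb)

lemma le_young (a l : ℝ≥0) (hl : 0 < l) : (a : ℝ≥0∞) ≤ l + (l : ℝ≥0∞)⁻¹ * (a : ℝ≥0∞) ^ 2 := by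
  rw [← ENNReal.coe_inv hl.ne']
  norm_cast
  rcases le_total a l with h | h
  · exact h.trans le_self_add
  · refine le_trans ?_ le_add_self
    rw [inv_mul_eq_div, le_div_iff₀ hl, sq]
    gcongr

/-- lower bound for the energy of slices whose average is away from the wells -/
lemma energy_lower {ω : Set (EuclideanSpace ℝ (Fin m))} (hωo : IsOpen ω)
    (hωc : IsConnected ω) (hωb : Bornology.IsBounded ω) (hωl : LipschitzBoundary ω)
    {W : EuclideanSpace ℝ (Fin N) → ℝ≥0∞} (hlsc : LowerSemicontinuous W)
    (hH2 : ∃ c : ℝ≥0∞, 0 < c ∧ ∃ R : ℝ, ∀ z : EuclideanSpace ℝ (Fin N), R ≤ ‖z‖ → c ≤ W z)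
    {ε : ℝ} (hε : 0 < ε) :
    ∃ κ : ℝ≥0∞, 0 < κ ∧ ∀ v : EuclideanSpace ℝ (Fin m) → EuclideanSpace ℝ (Fin N),
      PNice ω v → IntegrableOn v ω →
      (∀ w, W w = 0 → ε ≤ dist (⨍ x in ω, v x) w) →
      κ ≤ ∫⁻ x in ω, (‖fderiv ℝ v x‖ₑ ^ 2 + W (v x)) := by
  obtain ⟨C, hC⟩ := poincare (N := N) hωo hωc hωb hωl
  obtain ⟨k, hk, hkW⟩ := W_pos_away hlsc hH2 (ε := ε / 4) (by positivity)
  have hM0 : volume ω ≠ 0 := (hωo.measure_pos volume hωc.nonempty).ne'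
  have hMt : volume ω ≠ ⊤ := hωb.measure_lt_top.ne
  set M := (volume ω).toReal with hM
  have hMpos : 0 < M := ENNReal.toReal_pos hM0 hMt
  have hMM : volume ω = ENNReal.ofReal M := (ENNReal.ofReal_toReal hMt).symm
  -- the threshold
  set η : ℝ := ε * M / 4 with hη
  have hηpos : 0 < η := by positivity
  set l : ℝ≥0 := (η / ((C + 1) * (M + 1))).toNNReal with hl
  have hl' : (l : ℝ) = η / ((C + 1) * (M + 1)) := Real.coe_toNNReal _ (by positivity)
  have hlpos : 0 < l := by rw [hl, Real.toNNReal_pos]; positivity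
  refine ⟨min ((l : ℝ≥0∞) ^ 2) (k * ENNReal.ofReal (M / 2)), ?_, ?_⟩
  · refine lt_min (by positivity) (ENNReal.mul_pos hk.ne' ?_)
    rw [Ne, ENNReal.ofReal_eq_zero, not_le]; positivity
  intro v hv hvi hfar
  by_contra! hlt
  have hvm := hv.1
  have hWm : Measurable W := hlsc.measurable
  obtain ⟨hlt1, hlt2⟩ := lt_min_iff.1 hlt
  have hGm : Measurable (fun x => ‖fderiv ℝ v x‖ₑ) := (measurable_fderiv ℝ v).enorm
  -- gradient is small in L1
  have hgrad : gradE ω v ≤ ENNReal.ofReal (l * (M + 1)) := by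
    calc gradE ω v ≤ ∫⁻ x in ω, ((l : ℝ≥0∞) + (l : ℝ≥0∞)⁻¹ * ‖fderiv ℝ v x‖ₑ ^ 2) :=
          lintegral_mono fun x => le_young _ _ hlpos
      _ = l * volume ω + (l : ℝ≥0∞)⁻¹ * ∫⁻ x in ω, ‖fderiv ℝ v x‖ₑ ^ 2 := by
          rw [lintegral_add_left measurable_const, setLIntegral_const,
            lintegral_const_mul _ (hGm.pow_const 2)]
      _ ≤ l * volume ω + (l : ℝ≥0∞)⁻¹ * (l : ℝ≥0∞) ^ 2 := by
          gcongr
          exact (lintegral_mono fun x => le_self_add).trans hlt1.le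
      _ = ENNReal.ofReal (l * (M + 1)) := by
          rw [sq, ← mul_assoc, ENNReal.inv_mul_cancel (by positivity) ENNReal.coe_ne_top, one_mul,
            hMM, mul_add, mul_one, ENNReal.ofReal_add (by positivity) (by positivity),
            ENNReal.ofReal_mul (by positivity), ENNReal.ofReal_coe_nnreal]
  obtain ⟨c, hc⟩ := hC v hv
  have hc2 : ∫⁻ x in ω, ‖v x - c‖ₑ ≤ ENNReal.ofReal η := by
    refine hc.trans ?_
    calc (C : ℝ≥0∞) * gradE ω v ≤ C * ENNReal.ofReal (l * (M + 1)) := by gcongr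
      _ = ENNReal.ofReal (C * (l * (M + 1))) := by
          rw [ENNReal.ofReal_mul (p := (C : ℝ)) (by positivity), ENNReal.ofReal_coe_nnreal]
      _ ≤ ENNReal.ofReal η := by
          apply ENNReal.ofReal_le_ofReal
          rw [hl']
          have : (C : ℝ) * (η / ((C + 1) * (M + 1)) * (M + 1)) = (C / (C + 1)) * η := by
            field_simp
          rw [this]
          apply mul_le_of_le_one_left hηpos.le
          rw [div_le_one (by positivity)]
          linarith
  -- average is close to c
  have havg : dist (⨍ x in ω, v x) c ≤ ε / 4 := by
    have h1 : (⨍ x in ω, v x) - c = M⁻¹ • ∫ x in ω, (v x - c) := by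
      rw [integral_sub hvi (integrableOn_const hMt), setAverage_eq, setIntegral_const,
        smul_sub, smul_smul]
      simp only [Measure.real, ← hM]
      rw [inv_mul_cancel₀ hMpos.ne', one_smul]
    have h2 : ‖∫ x in ω, (v x - c)‖ ≤ η := by
      have := (enorm_integral_le_lintegral_enorm (μ := volume.restrict ω)
        (fun x => v x - c)).trans hc2
      rwa [← ofReal_norm, ENNReal.ofReal_le_ofReal_iff hηpos.le] at this
    rw [dist_eq_norm, h1, norm_smul, Real.norm_of_nonneg (by positivity)]
    calc M⁻¹ * ‖∫ x in ω, (v x - c)‖ ≤ M⁻¹ * η := by gcongr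
      _ = ε / 4 := by rw [hη]; field_simp
  -- Chebyshev
  have hcheb : volume (ω ∩ {x | ENNReal.ofReal (ε / 2) ≤ ‖v x - c‖ₑ}) ≤ ENNReal.ofReal (M / 2) := by
    have h1 := mul_meas_ge_le_lintegral (μ := volume.restrict ω) (f := fun x => ‖v x - c‖ₑ)
      (by fun_prop) (ENNReal.ofReal (ε / 2))
    rw [Measure.restrict_apply (measurableSet_le (by fun_prop) (by fun_prop)), inter_comm] at h1
    have h2 := h1.trans hc2
    have h3 : ENNReal.ofReal η = ENNReal.ofReal (ε / 2) * ENNReal.ofReal (M / 2) := by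
      rw [← ENNReal.ofReal_mul (by positivity)]; congr 1; rw [hη]; ring
    rw [h3] at h2
    rwa [ENNReal.mul_le_mul_iff_right (by rw [Ne, ENNReal.ofReal_eq_zero, not_le]; positivity)
      ENNReal.ofReal_ne_top] at h2
  set A := ω ∩ {x | ‖v x - c‖ₑ < ENNReal.ofReal (ε / 2)} with hA
  have hAm : MeasurableSet A :=
    hωo.measurableSet.inter (measurableSet_lt (by fun_prop) (by fun_prop))
  have hAvol : ENNReal.ofReal (M / 2) ≤ volume A := by
    have h1 : volume ω ≤ volume A + ENNReal.ofReal (M / 2) := by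
      refine le_trans ?_ (add_le_add le_rfl hcheb)
      refine le_trans (measure_mono ?_) (measure_union_le _ _)
      intro x hx
      rcases lt_or_ge (‖v x - c‖ₑ) (ENNReal.ofReal (ε / 2)) with h | h
      · exact Or.inl ⟨hx, h⟩
      · exact Or.inr ⟨hx, h⟩
    have h2 : volume ω = ENNReal.ofReal (M / 2) + ENNReal.ofReal (M / 2) := by
      rw [← ENNReal.ofReal_add (by positivity) (by positivity), add_halves, hMM]
    rw [h2] at h1
    exact (ENNReal.add_le_add_iff_right ENNReal.ofReal_ne_top).1 h1
  refine absurd hlt2 (not_lt.2 ?_)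
  calc k * ENNReal.ofReal (M / 2) ≤ k * volume A := by gcongr
    _ = ∫⁻ x in A, k := by rw [setLIntegral_const]
    _ ≤ ∫⁻ x in A, (‖fderiv ℝ v x‖ₑ ^ 2 + W (v x)) := by
        refine setLIntegral_mono' hAm fun x hx => ?_
        refine le_trans (hkW _ fun w hw => ?_) le_add_self
        have h1 := hfar w hw
        have h2 : dist (v x) c < ε / 2 := by
          have := hx.2
          rw [mem_ofPred_eq, ← ofReal_norm, ENNReal.ofReal_lt_ofReal_iff (by positivity)] at this
          rwa [dist_eq_norm]
        have h3 := dist_triangle (⨍ x in ω, v x) c w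
        have h4 := dist_triangle c (v x) w
        rw [dist_comm c (v x)] at h4
        linarith
    _ ≤ _ := lintegral_mono_set inter_subset_left

lemma tail_small {φ : ℝ → ℝ≥0∞} (hφ : ∫⁻ t, φ t < ⊤) {c : ℝ≥0∞} (hc : 0 < c) :
    ∃ T : ℝ, ∫⁻ t in Ioi T, φ t < c := by
  have h := tendsto_measure_iInter_atTop (μ := volume.withDensity φ) (s := fun n : ℕ => Ioi (n : ℝ))
    (fun n => measurableSet_Ioi.nullMeasurableSet)
    (fun a b hab => Ioi_subset_Ioi (by exact_mod_cast hab))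
    ⟨0, by
      rw [withDensity_apply _ measurableSet_Ioi]
      exact ((setLIntegral_le_lintegral _ _).trans_lt hφ).ne⟩
  have h0 : ⋂ n : ℕ, Ioi (n : ℝ) = ∅ := by
    ext x
    simp only [mem_iInter, mem_Ioi, mem_empty_iff_false, iff_false, not_forall, not_lt]
    exact exists_nat_ge x
  rw [h0, measure_empty] at h
  obtain ⟨n, hn⟩ := (h.eventually (gt_mem_nhds hc)).exists
  refine ⟨n, ?_⟩
  rwa [Function.comp, withDensity_apply _ measurableSet_Ioi] at hn

lemma abstract_limit {f : ℝ → EuclideanSpace ℝ (Fin N)} {φ : ℝ → ℝ≥0∞} (hφ : ∫⁻ t, φ t < ⊤)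
    (huc : ∀ ε > 0, ∃ δ > 0, ∀ s t : ℝ, s ≤ t → t ≤ s + δ → dist (f t) (f s) ≤ ε)
    {Z : Set (EuclideanSpace ℝ (Fin N))} (hZ : Z.Finite)
    (hlow : ∀ ε > (0:ℝ), ∃ c : ℝ≥0∞, 0 < c ∧ ∀ t, (∀ z ∈ Z, ε ≤ dist (f t) z) → c ≤ φ t) :
    ∃ z ∈ Z, Tendsto f atTop (𝓝 z) := by
  have hcont : Continuous f := by
    rw [Metric.continuous_iff]
    intro b ε hε
    obtain ⟨δ, hδ, h⟩ := huc (ε / 2) (by positivity)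
    refine ⟨δ, hδ, fun a ha => ?_⟩
    rw [Real.dist_eq, abs_lt] at ha
    rcases le_total a b with hab | hab
    · have := h a b hab (by linarith)
      rw [dist_comm]; linarith
    · have := h b a hab (by linarith)
      linarith
  have hnear : ∀ ε > (0:ℝ), ∃ T : ℝ, ∀ t > T, ∃ z ∈ Z, dist (f t) z < ε := by
    intro ε hε
    obtain ⟨δ, hδ, h⟩ := huc (ε / 2) (by positivity)
    obtain ⟨c, hc, hcl⟩ := hlow (ε / 2) (by positivity)
    obtain ⟨T, hT⟩ := tail_small hφ (c := c * ENNReal.ofReal δ)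
      (ENNReal.mul_pos hc.ne' (by rw [Ne, ENNReal.ofReal_eq_zero, not_le]; exact hδ))
    refine ⟨T, fun t ht => ?_⟩
    by_contra! hcon
    refine absurd hT (not_lt.2 ?_)
    calc c * ENNReal.ofReal δ = ∫⁻ s in Icc t (t + δ), c := by
          rw [setLIntegral_const, Real.volume_Icc]; simp
      _ ≤ ∫⁻ s in Icc t (t + δ), φ s := by
          refine setLIntegral_mono' measurableSet_Icc fun s hs => hcl s fun z hz => ?_
          have h1 := h t s hs.1 hs.2
          have h2 := dist_triangle (f t) (f s) z
          rw [dist_comm (f t) (f s)] at h2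
          linarith [hcon z hz]
      _ ≤ _ := lintegral_mono_set fun s hs => lt_of_lt_of_le ht hs.1
  obtain ⟨d, hd, hsep⟩ : ∃ d > (0:ℝ), ∀ x ∈ Z, ∀ y ∈ Z, x ≠ y → d ≤ dist x y := by
    by_cases hs : Z.Nontrivial
    · exact ⟨Z.infsep, (hZ.infsep_pos_iff_nontrivial).2 hs, fun x hx y hy hxy =>
        infsep_le_dist_of_mem hx hy hxy⟩
    · rw [not_nontrivial_iff] at hs
      exact ⟨1, one_pos, fun x hx y hy hxy => absurd (hs hx hy) hxy⟩
  obtain ⟨T, hT⟩ := hnear (d / 2) (by positivity)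
  obtain ⟨z₀, hz₀, hz₀d⟩ := hT (T + 1) (by linarith)
  have hdisj : Disjoint (ball z₀ (d / 2)) (⋃ z ∈ Z \ {z₀}, ball z (d / 2)) := by
    rw [disjoint_iUnion₂_right]
    intro z hz
    refine ball_disjoint_ball ?_
    have := hsep z₀ hz₀ z hz.1 (fun h => hz.2 h.symm)
    linarith
  have hsub : f '' Ioi T ⊆ ball z₀ (d / 2) := by
    refine IsPreconnected.subset_left_of_subset_union isOpen_ball
      (isOpen_biUnion fun z _ => isOpen_ball) hdisj ?_ ?_ (isPreconnected_Ioi.image _ hcont.continuousOn)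
    · rintro _ ⟨t, ht, rfl⟩
      obtain ⟨z, hz, hzd⟩ := hT t ht
      by_cases h : z = z₀
      · left; rw [← h]; exact hzd
      · right; exact mem_biUnion (x := z) ⟨hz, h⟩ hzd
    · exact ⟨f (T + 1), ⟨T + 1, by simp, rfl⟩, hz₀d⟩
  refine ⟨z₀, hz₀, ?_⟩
  rw [Metric.tendsto_atTop]
  intro ε hε
  obtain ⟨T', hT'⟩ := hnear (min ε (d / 2)) (by positivity)
  refine ⟨max T T' + 1, fun t ht => ?_⟩
  obtain ⟨z, hz, hzd⟩ := hT' t (by linarith [le_max_right T T'])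
  have h1 : dist (f t) z₀ < d / 2 := hsub ⟨t, by rw [mem_Ioi]; linarith [le_max_left T T'], rfl⟩
  have h2 : z = z₀ := by
    by_contra hne
    have h3 := hsep z hz z₀ hz₀ hne
    have h4 := dist_triangle_left z z₀ (f t)
    have h5 := lt_of_lt_of_le hzd (min_le_right _ _)
    linarith
  rw [← h2]
  exact lt_of_lt_of_le hzd (min_le_left _ _)


lemma joint_grad {ω : Set (EuclideanSpace ℝ (Fin m))} (hωo : IsOpen ω)
    {u : ℝ × EuclideanSpace ℝ (Fin m) → EuclideanSpace ℝ (Fin N)} (hu : Measurable u)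
    (hd : ∀ t : ℝ, DifferentiableOn ℝ (fun y => u (t, y)) ω) :
    ∃ G : ℝ × EuclideanSpace ℝ (Fin m) → ℝ≥0∞, Measurable G ∧
      ∀ t, ∀ y ∈ ω, G (t, y) = ‖fderiv ℝ (fun y => u (t, y)) y‖ₑ := by
  classical
  set Ω : Set (ℝ × EuclideanSpace ℝ (Fin m)) := Set.univ ×ˢ ω with hΩ
  have hΩm : MeasurableSet Ω := MeasurableSet.univ.prod hωo.measurableSet
  have hdir : ∀ e : EuclideanSpace ℝ (Fin m),
      Measurable (Ω.indicator fun p => fderiv ℝ (fun y => u (p.1, y)) p.2 e) := by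
    intro e
    refine measurable_of_tendsto_metrizable (f := fun (n : ℕ) => Ω.indicator fun p =>
      ((n : ℝ)) • (u (p.1, p.2 + ((n : ℝ))⁻¹ • e) - u p)) ?_ ?_
    · intro n
      refine Measurable.indicator ?_ hΩm
      have : Measurable (fun p : ℝ × EuclideanSpace ℝ (Fin m) => u (p.1, p.2 + ((n : ℝ))⁻¹ • e)) :=
        hu.comp (by fun_prop)
      fun_prop
    · rw [tendsto_pi_nhds]
      rintro ⟨t, y⟩
      by_cases hp : (t, y) ∈ Ω
      · simp only [indicator_of_mem hp]
        have hyω : y ∈ ω := hp.2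
        have hD : HasFDerivAt (fun y => u (t, y)) (fderiv ℝ (fun y => u (t, y)) y) y :=
          ((hd t y hyω).differentiableAt (hωo.mem_nhds hyω)).hasFDerivAt
        exact (hD.lim_real e).comp tendsto_natCast_atTop_atTop
      · simp only [indicator_of_notMem hp]
        exact tendsto_const_nhds
  let b := EuclideanSpace.basisFun (Fin m) ℝ
  let L : ℝ × EuclideanSpace ℝ (Fin m) → (EuclideanSpace ℝ (Fin m) →L[ℝ] EuclideanSpace ℝ (Fin N)) :=
    fun p => ∑ i, (EuclideanSpace.proj (𝕜 := ℝ) i :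
      EuclideanSpace ℝ (Fin m) →L[ℝ] ℝ).smulRight
        ((Ω.indicator fun p => fderiv ℝ (fun y => u (p.1, y)) p.2 (b i)) p)
  have hLm : Measurable L := by
    have h : ∀ i : Fin m, Measurable (fun p => (EuclideanSpace.proj (𝕜 := ℝ) i :
      EuclideanSpace ℝ (Fin m) →L[ℝ] ℝ).smulRight
        ((Ω.indicator fun p => fderiv ℝ (fun y => u (p.1, y)) p.2 (b i)) p)) := by
      intro i
      have hc : Continuous (fun w : EuclideanSpace ℝ (Fin N) => (EuclideanSpace.proj (𝕜 := ℝ) i :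
        EuclideanSpace ℝ (Fin m) →L[ℝ] ℝ).smulRight w) :=
        (ContinuousLinearMap.smulRightL ℝ (EuclideanSpace ℝ (Fin m)) (EuclideanSpace ℝ (Fin N))
          (EuclideanSpace.proj (𝕜 := ℝ) i)).continuous
      have hci := hc.measurable
      exact Measurable.comp hci (hdir (b i))
    exact Finset.measurable_fun_sum Finset.univ fun i _ => h i
  refine ⟨fun p => ‖L p‖ₑ, hLm.enorm, ?_⟩
  · intro t y hy
    have hp : (t, y) ∈ Ω := ⟨mem_univ _, hy⟩
    have hL : L (t, y) = fderiv ℝ (fun y => u (t, y)) y := by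
      refine ContinuousLinearMap.ext fun w => ?_
      simp only [L, indicator_of_mem hp]
      conv_rhs => rw [← b.sum_repr w]
      simp [b, ContinuousLinearMap.sum_apply]
    simp only [hL]

lemma slice_uc {ω : Set (EuclideanSpace ℝ (Fin m))} (hωo : IsOpen ω)
    (hωc : IsConnected ω) (hωb : Bornology.IsBounded ω)
    {u g : ℝ × EuclideanSpace ℝ (Fin m) → EuclideanSpace ℝ (Fin N)} (hg : Measurable g)
    (hFTC : ∀ x' ∈ ω, ∀ s t : ℝ, u (t, x') - u (s, x') = ∫ r in s..t, g (r, x'))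
    (hint : ∀ t : ℝ, IntegrableOn (fun y => u (t, y)) ω)
    (hE : (∫⁻ p in (Set.univ ×ˢ ω : Set (ℝ × EuclideanSpace ℝ (Fin m))), ‖g p‖ₑ ^ 2) < ⊤) :
    ∀ ε > (0:ℝ), ∃ δ > 0, ∀ s t : ℝ, s ≤ t → t ≤ s + δ →
      dist (⨍ x' in ω, u (t, x')) (⨍ x' in ω, u (s, x')) ≤ ε := by
  intro ε hε
  have hM0 : volume ω ≠ 0 := (hωo.measure_pos volume hωc.nonempty).ne'
  have hMt : volume ω ≠ ⊤ := hωb.measure_lt_top.ne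
  set M := (volume ω).toReal with hM
  have hMpos : 0 < M := ENNReal.toReal_pos hM0 hMt
  have hMM : volume ω = ENNReal.ofReal M := (ENNReal.ofReal_toReal hMt).symm
  rw [Measure.volume_eq_prod, ← Measure.prod_restrict, Measure.restrict_univ,
    lintegral_prod_symm' _ (by fun_prop)] at hE
  set Γ' := ∫⁻ y in ω, ∫⁻ r, ‖g (r, y)‖ₑ ^ 2 with hΓ'
  set Γ := Γ'.toReal with hΓ
  have hΓΓ : Γ' = ENNReal.ofReal Γ := (ENNReal.ofReal_toReal hE.ne).symm
  have hΓ0 : 0 ≤ Γ := ENNReal.toReal_nonneg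
  set l : ℝ≥0 := (2 * Γ / (ε * M) + 1).toNNReal with hl
  have hl' : (l : ℝ) = 2 * Γ / (ε * M) + 1 := Real.coe_toNNReal _ (by positivity)
  have hlpos : 0 < l := by rw [hl, Real.toNNReal_pos]; positivity
  have hlpos' : (0 : ℝ) < l := hlpos
  refine ⟨ε / (2 * l), by positivity, fun s t hst hts => ?_⟩
  have hbound : ∫⁻ y in ω, ‖u (t, y) - u (s, y)‖ₑ ≤ ENNReal.ofReal (ε * M) := by
    calc ∫⁻ y in ω, ‖u (t, y) - u (s, y)‖ₑ
        ≤ ∫⁻ y in ω, ((l : ℝ≥0∞) * ENNReal.ofReal (ε / (2 * l)) +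
            (l : ℝ≥0∞)⁻¹ * ∫⁻ r, ‖g (r, y)‖ₑ ^ 2) := by
          refine setLIntegral_mono' hωo.measurableSet fun y hy => ?_
          rw [hFTC y hy s t, intervalIntegral.integral_of_le hst]
          refine (enorm_integral_le_lintegral_enorm _).trans ?_
          calc ∫⁻ r in Ioc s t, ‖g (r, y)‖ₑ
              ≤ ∫⁻ r in Ioc s t, ((l : ℝ≥0∞) + (l : ℝ≥0∞)⁻¹ * ‖g (r, y)‖ₑ ^ 2) :=
                lintegral_mono fun r => le_young _ _ hlpos
            _ = l * volume (Ioc s t) + (l : ℝ≥0∞)⁻¹ * ∫⁻ r in Ioc s t, ‖g (r, y)‖ₑ ^ 2 := by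
                rw [lintegral_add_left measurable_const, setLIntegral_const,
                  lintegral_const_mul _ (by fun_prop)]
            _ ≤ _ := by
                rw [Real.volume_Ioc]
                gcongr
                · linarith
                · exact Measure.restrict_le_self
      _ = l * ENNReal.ofReal (ε / (2 * l)) * volume ω + (l : ℝ≥0∞)⁻¹ * Γ' := by
          rw [lintegral_add_left measurable_const, setLIntegral_const, lintegral_const_mul]
          exact Measurable.lintegral_prod_left' (f := fun p => ‖g p‖ₑ ^ 2) (by fun_prop)
      _ = ENNReal.ofReal (l * (ε / (2 * l)) * M + (l : ℝ)⁻¹ * Γ) := by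
          rw [hMM, hΓΓ, ENNReal.ofReal_add (by positivity) (by positivity),
            ENNReal.ofReal_mul (by positivity), ENNReal.ofReal_mul (p := (l : ℝ)) (by positivity),
            ENNReal.ofReal_mul (p := (l : ℝ)⁻¹) (by positivity), ENNReal.ofReal_inv_of_pos hlpos',
            ENNReal.ofReal_coe_nnreal]
      _ ≤ ENNReal.ofReal (ε * M) := by
          apply ENNReal.ofReal_le_ofReal
          have h1 : (l : ℝ) * (ε / (2 * l)) * M = ε * M / 2 := by field_simp
          have h2 : (l : ℝ)⁻¹ * Γ ≤ ε * M / 2 := by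
            rw [inv_mul_le_iff₀ hlpos', hl']
            have : (2 * Γ / (ε * M) + 1) * (ε * M / 2) = Γ + ε * M / 2 := by field_simp
            rw [this]
            have : 0 < ε * M := by positivity
            linarith
          linarith
  have h1 : (⨍ x' in ω, u (t, x')) - (⨍ x' in ω, u (s, x')) =
      M⁻¹ • ∫ y in ω, (u (t, y) - u (s, y)) := by
    rw [integral_sub (hint t) (hint s), setAverage_eq, setAverage_eq, smul_sub]
    simp only [Measure.real, ← hM]
  have h2 : ‖∫ y in ω, (u (t, y) - u (s, y))‖ ≤ ε * M := by
    have := (enorm_integral_le_lintegral_enorm (μ := volume.restrict ω)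
      (fun y => u (t, y) - u (s, y))).trans hbound
    rwa [← ofReal_norm, ENNReal.ofReal_le_ofReal_iff (by positivity)] at this
  rw [dist_eq_norm, h1, norm_smul, Real.norm_of_nonneg (by positivity), inv_mul_le_iff₀ hMpos]
  linarith

end helpers

/-- **Theorem 1, convergence of averages.** Under the hypotheses of the main
theorem, the average `ū(x₁) = ⨍_ω u(x₁, x') dx'` converges to wells `u^± ∈ {W = 0}` as
`x₁ → ±∞`. -/
theorem main_average_convergence {m N : ℕ} (ω : Set (EuclideanSpace ℝ (Fin m)))
    (hωo : IsOpen ω) (hωc : IsConnected ω) (hωb : Bornology.IsBounded ω)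
    (hωl : LipschitzBoundary ω)
    (W : EuclideanSpace ℝ (Fin N) → ℝ≥0∞) (hlsc : LowerSemicontinuous W)
    (hH1 : {z : EuclideanSpace ℝ (Fin N) | W z = 0}.Finite)
    (hH2 : ∃ c : ℝ≥0∞, 0 < c ∧ ∃ R : ℝ, ∀ z : EuclideanSpace ℝ (Fin N), R ≤ ‖z‖ → c ≤ W z)
    (u g : ℝ × EuclideanSpace ℝ (Fin m) → EuclideanSpace ℝ (Fin N))
    (hu : Measurable u) (hg : Measurable g)
    (hFTC : ∀ x' ∈ ω, ∀ s t : ℝ, u (t, x') - u (s, x') = ∫ r in s..t, g (r, x'))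
    (hslice : ∀ t : ℝ, MemH1 ω (fun y => u (t, y)))
    (hE : (∫⁻ p in (Set.univ ×ˢ ω : Set (ℝ × EuclideanSpace ℝ (Fin m))),
        ((‖g p‖₊ : ℝ≥0∞) ^ 2 +
          (‖fderivWithin ℝ (fun y => u (p.1, y)) ω p.2‖₊ : ℝ≥0∞) ^ 2 + W (u p))) < ⊤) :
    ∃ um up : EuclideanSpace ℝ (Fin N), W um = 0 ∧ W up = 0 ∧
      Tendsto (fun t => ⨍ x' in ω, u (t, x')) atTop (nhds up) ∧
      Tendsto (fun t => ⨍ x' in ω, u (t, x')) atBot (nhds um) := by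
  have hdiff : ∀ t : ℝ, DifferentiableOn ℝ (fun y => u (t, y)) ω := fun t => (hslice t).1
  have hint : ∀ t : ℝ, IntegrableOn (fun y => u (t, y)) ω := fun t => (hslice t).2.1
  have hWm : Measurable W := hlsc.measurable
  obtain ⟨G, hGm, hG⟩ := joint_grad hωo hu hdiff
  have hΩm : MeasurableSet (Set.univ ×ˢ ω : Set (ℝ × EuclideanSpace ℝ (Fin m))) :=
    MeasurableSet.univ.prod hωo.measurableSet
  have hE1 : (∫⁻ p in (Set.univ ×ˢ ω : Set (ℝ × EuclideanSpace ℝ (Fin m))), ‖g p‖ₑ ^ 2) < ⊤ := by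
    refine lt_of_le_of_lt (lintegral_mono fun p => ?_) hE
    exact le_self_add.trans le_self_add
  have hE2 : (∫⁻ p in (Set.univ ×ˢ ω : Set (ℝ × EuclideanSpace ℝ (Fin m))),
      (G p ^ 2 + W (u p))) < ⊤ := by
    refine lt_of_le_of_lt (setLIntegral_mono' hΩm fun p hp => ?_) hE
    rw [hG p.1 p.2 hp.2, ← fderivWithin_of_isOpen hωo hp.2]
    gcongr
    exact le_add_self
  have hφ : ∫⁻ t, ∫⁻ y in ω, (‖fderiv ℝ (fun y => u (t, y)) y‖ₑ ^ 2 + W (u (t, y))) < ⊤ := by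
    rw [Measure.volume_eq_prod, ← Measure.prod_restrict, Measure.restrict_univ,
      lintegral_prod _ (by fun_prop)] at hE2
    refine lt_of_le_of_lt (lintegral_mono fun t => ?_) hE2
    refine setLIntegral_mono' hωo.measurableSet fun y hy => ?_
    rw [hG t y hy]
  have huc := slice_uc hωo hωc hωb hg hFTC hint hE1
  have hlow : ∀ ε > (0:ℝ), ∃ c : ℝ≥0∞, 0 < c ∧ ∀ t,
      (∀ z ∈ {z | W z = 0}, ε ≤ dist (⨍ x' in ω, u (t, x')) z) →
      c ≤ ∫⁻ y in ω, (‖fderiv ℝ (fun y => u (t, y)) y‖ₑ ^ 2 + W (u (t, y))) := by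
    intro ε hε
    obtain ⟨κ, hκ, h⟩ := energy_lower (N := N) hωo hωc hωb hωl hlsc hH2 hε
    exact ⟨κ, hκ, fun t ht => h _ ⟨hu.comp (by fun_prop), hdiff t⟩ (hint t) ht⟩
  obtain ⟨up, hup, hupt⟩ := abstract_limit hφ huc hH1 hlow
  obtain ⟨um, hum, humt⟩ := abstract_limit
    (f := fun t => ⨍ x' in ω, u (-t, x'))
    (φ := fun t => ∫⁻ y in ω, (‖fderiv ℝ (fun y => u (-t, y)) y‖ₑ ^ 2 + W (u (-t, y))))
    (by
      rw [lintegral_neg_eq_self (μ := volume) (fun t : ℝ =>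
        ∫⁻ y in ω, (‖fderiv ℝ (fun y => u (t, y)) y‖ₑ ^ 2 + W (u (t, y))))]
      exact hφ)
    (by
      intro ε hε
      obtain ⟨δ, hδ, h⟩ := huc ε hε
      refine ⟨δ, hδ, fun s t hst hts => ?_⟩
      rw [dist_comm]
      exact h (-t) (-s) (by linarith) (by linarith))
    hH1
    (by
      intro ε hε
      obtain ⟨c, hc, h⟩ := hlow ε hε
      exact ⟨c, hc, fun t ht => h (-t) ht⟩)
  refine ⟨um, up, hum, hup, hupt, ?_⟩
  have := humt.comp tendsto_neg_atBot_atTop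
  simpa [Function.comp_def] using this
end

section
/- Let W : ℝ^N → [0,∞] be lower semicontinuous with finite zero set Σ and liminf_{|z|→∞} W(z) > 0. Then for every ε > 0, κ_ε := inf{ W(z) : z ∈ ℝ^N, dist(z,Σ) ≥ ε } > 0, and consequently any continuous ū : [0,∞) → ℝ^N with ∫_0^∞ (|ū'|² + W(ū)) dt < ∞ and ū(t_n) → u⁺ ∈ Σ along some sequence t_n → ∞ satisfies ū(t) → u⁺ as t → ∞. -/
open MeasureTheory Metric Set Filter Topology
open scoped ENNReal NNReal

theorem aux_kappa {N : ℕ}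
    (W : EuclideanSpace ℝ (Fin N) → ℝ≥0∞) (hlsc : LowerSemicontinuous W)
    (hH2 : ∃ c : ℝ≥0∞, 0 < c ∧ ∃ R : ℝ, ∀ z : EuclideanSpace ℝ (Fin N), R ≤ ‖z‖ → c ≤ W z)
    (ε : ℝ) (hε : 0 < ε) : ∃ κ : ℝ≥0∞, 0 < κ ∧
      ∀ z : EuclideanSpace ℝ (Fin N),
        ε ≤ Metric.infDist z {z : EuclideanSpace ℝ (Fin N) | W z = 0} → κ ≤ W z := by
  obtain ⟨c, hc, R, hR⟩ := hH2
  set S := {z : EuclideanSpace ℝ (Fin N) | W z = 0} with hS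
  set K := closedBall (0 : EuclideanSpace ℝ (Fin N)) R ∩ {z | ε ≤ Metric.infDist z S} with hK
  have hKc : IsCompact K :=
    (isCompact_closedBall _ _).inter_right
      (isClosed_le continuous_const (Metric.continuous_infDist_pt S))
  rcases K.eq_empty_or_nonempty with h | h
  · refine ⟨c, hc, fun z hz => hR z ?_⟩
    by_contra hlt
    push Not at hlt
    have : z ∈ K := ⟨by simpa using hlt.le, hz⟩
    rw [h] at this
    exact this
  · obtain ⟨z0, hz0, hmin⟩ := (hlsc.lowerSemicontinuousOn K).exists_isMinOn h hKc
    refine ⟨min c (W z0), lt_min hc ?_, fun z hz => ?_⟩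
    · rw [pos_iff_ne_zero]
      intro h0
      have h1 : Metric.infDist z0 S = 0 := Metric.infDist_zero_of_mem h0
      have h2 : ε ≤ Metric.infDist z0 S := hz0.2
      linarith
    · by_cases hz' : R ≤ ‖z‖
      · exact (min_le_left _ _).trans (hR z hz')
      · push Not at hz'
        exact (min_le_right _ _).trans (hmin ⟨by simpa using hz'.le, hz⟩)

theorem aux_crossing (f : ℝ → ℝ) (a b α β : ℝ) (hab : a ≤ b) (hf : ContinuousOn f (Icc a b))
    (ha : f a ≤ α) (hb : β ≤ f b) :
    ∃ t1 t2, a ≤ t1 ∧ t1 ≤ t2 ∧ t2 ≤ b ∧ f t1 ≤ α ∧ β ≤ f t2 ∧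
      ∀ t ∈ Ioo t1 t2, α < f t ∧ f t < β := by
  have hc1 : IsCompact (Icc a b ∩ f ⁻¹' Ici β) :=
    isCompact_Icc.of_isClosed_subset (hf.preimage_isClosed_of_isClosed isClosed_Icc isClosed_Ici)
      inter_subset_left
  obtain ⟨t2, ht2⟩ := hc1.exists_isLeast ⟨b, ⟨hab, le_rfl⟩, hb⟩
  have hab2 : a ≤ t2 := ht2.1.1.1
  have hb2 : t2 ≤ b := ht2.1.1.2
  have hf2 : ContinuousOn f (Icc a t2) := hf.mono (Icc_subset_Icc_right hb2)
  have hc2 : IsCompact (Icc a t2 ∩ f ⁻¹' Iic α) :=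
    isCompact_Icc.of_isClosed_subset (hf2.preimage_isClosed_of_isClosed isClosed_Icc isClosed_Iic)
      inter_subset_left
  obtain ⟨t1, ht1⟩ := hc2.exists_isGreatest ⟨a, ⟨le_rfl, hab2⟩, ha⟩
  refine ⟨t1, t2, ht1.1.1.1, ht1.1.1.2, hb2, ht1.1.2, ht2.1.2, fun t ht => ⟨?_, ?_⟩⟩
  · by_contra h
    push Not at h
    exact absurd (ht1.2 ⟨⟨ht1.1.1.1.trans ht.1.le, ht.2.le⟩, h⟩) (not_le.2 ht.1)
  · by_contra h
    push Not at h
    exact absurd (ht2.2 ⟨⟨ht1.1.1.1.trans ht.1.le, ht.2.le.trans hb2⟩, h⟩) (not_le.2 ht.2)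

theorem aux_tail (f : ℝ → ℝ≥0∞) (hf : ∫⁻ t in Ici (0:ℝ), f t < ⊤) (η : ℝ≥0∞) (hη : 0 < η) :
    ∃ T : ℝ, 0 ≤ T ∧ ∫⁻ t in Ici T, f t < η := by
  set ν := (volume.restrict (Ici (0:ℝ))).withDensity f with hν
  have hfin : ν univ < ⊤ := by
    rw [hν, withDensity_apply _ MeasurableSet.univ, Measure.restrict_univ]
    exact hf
  have ht : Tendsto (fun n : ℕ => ν (Ici (n : ℝ))) atTop (𝓝 (ν (⋂ n : ℕ, Ici (n : ℝ)))) := by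
    apply tendsto_measure_iInter_atTop
    · intro n
      exact measurableSet_Ici.nullMeasurableSet
    · intro m n hmn
      exact Ici_subset_Ici.2 (by exact_mod_cast hmn)
    · exact ⟨0, ((measure_mono (subset_univ _)).trans_lt hfin).ne⟩
  have he : (⋂ n : ℕ, Ici (n : ℝ)) = ∅ := by
    ext x
    simp only [mem_iInter, mem_Ici, mem_empty_iff_false, iff_false, not_forall, not_le]
    exact exists_nat_gt x
  rw [he, measure_empty] at ht
  obtain ⟨n, hn⟩ := (ht.eventually (gt_mem_nhds hη)).exists
  refine ⟨n, n.cast_nonneg, ?_⟩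
  rw [hν, withDensity_apply _ measurableSet_Ici, Measure.restrict_restrict measurableSet_Ici] at hn
  rwa [inter_eq_left.2 (Ici_subset_Ici.2 n.cast_nonneg)] at hn

theorem aux_young (k : ℝ≥0) (x : ℝ≥0) (w : ℝ≥0∞) (h : (k : ℝ≥0∞) ^ 2 ≤ w) :
    2 * (k : ℝ≥0∞) * x ≤ (x : ℝ≥0∞) ^ 2 + w := by
  refine le_trans ?_ (add_le_add_right h _)
  have : 2 * k * x ≤ x ^ 2 + k ^ 2 := by
    rw [← NNReal.coe_le_coe]
    push_cast
    nlinarith [sq_nonneg ((x:ℝ) - k)]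
  exact_mod_cast this

/-- For `W : ℝ^N → [0,∞]` lower semicontinuous with finite zero set `Σ`
and `liminf_{|z|→∞} W > 0`: (a) for every `ε > 0`,
`κ_ε := inf { W(z) : dist(z,Σ) ≥ ε } > 0`; (b) consequently, any continuous
`ū : [0,∞) → ℝ^N` (with derivative `g` in the FTC sense) of finite energy
`∫_0^∞ (|ū'|² + W(ū)) < ∞` which converges to some `u⁺ ∈ Σ` along a sequence `t_n → ∞`
satisfies `ū(t) → u⁺` as `t → ∞`. -/
theorem kappa_pos_and_average_convergence {N : ℕ}
    (W : EuclideanSpace ℝ (Fin N) → ℝ≥0∞) (hlsc : LowerSemicontinuous W)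
    (hH1 : {z : EuclideanSpace ℝ (Fin N) | W z = 0}.Finite)
    (hH2 : ∃ c : ℝ≥0∞, 0 < c ∧ ∃ R : ℝ, ∀ z : EuclideanSpace ℝ (Fin N), R ≤ ‖z‖ → c ≤ W z) :
    (∀ ε : ℝ, 0 < ε → ∃ κ : ℝ≥0∞, 0 < κ ∧
      ∀ z : EuclideanSpace ℝ (Fin N),
        ε ≤ Metric.infDist z {z : EuclideanSpace ℝ (Fin N) | W z = 0} → κ ≤ W z) ∧
    ∀ (ubar gbar : ℝ → EuclideanSpace ℝ (Fin N)),
      ContinuousOn ubar (Set.Ici 0) → Measurable gbar →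
      (∀ s ∈ Set.Ici (0:ℝ), ∀ t ∈ Set.Ici (0:ℝ), ubar t - ubar s = ∫ r in s..t, gbar r) →
      (∫⁻ t in Set.Ici (0:ℝ), ((‖gbar t‖₊ : ℝ≥0∞) ^ 2 + W (ubar t))) < ⊤ →
      ∀ (tn : ℕ → ℝ), Tendsto tn atTop atTop →
      ∀ uplus : EuclideanSpace ℝ (Fin N), W uplus = 0 →
      Tendsto (fun n => ubar (tn n)) atTop (nhds uplus) →
      Tendsto ubar atTop (nhds uplus) := by
  refine ⟨fun ε hε => aux_kappa W hlsc hH2 ε hε, ?_⟩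
  intro u g hu hg hFTC hE tn htn up hup hconv
  set S := {z : EuclideanSpace ℝ (Fin N) | W z = 0} with hS
  obtain ⟨δ, hδ, hsep⟩ : ∃ δ > 0, ∀ y ∈ S, y ≠ up → δ ≤ dist y up := by
    have hfin : (S \ {up}).Finite := hH1.subset sdiff_subset
    have : (S \ {up})ᶜ ∈ 𝓝 up := hfin.isClosed.isOpen_compl.mem_nhds (by simp)
    obtain ⟨δ, hδ, hb⟩ := Metric.mem_nhds_iff.1 this
    refine ⟨δ, hδ, fun y hy hne => ?_⟩
    by_contra hlt
    push Not at hlt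
    exact hb (Metric.mem_ball.2 hlt) ⟨hy, hne⟩
  rw [Metric.tendsto_atTop]
  intro ε0 hε0
  set ε := min ε0 (δ / 2) with hεdef
  have hε : 0 < ε := lt_min hε0 (by linarith)
  have hεδ : ε ≤ δ / 2 := min_le_right _ _
  have hεε : ε ≤ ε0 := min_le_left _ _
  obtain ⟨κ, hκ, hκW⟩ := aux_kappa W hlsc hH2 (ε / 2) (by linarith)
  obtain ⟨k, hk, hkκ⟩ : ∃ k : ℝ≥0, 0 < k ∧ (k : ℝ≥0∞) ^ 2 ≤ κ := by
    obtain ⟨q, hq, hqκ⟩ := ENNReal.lt_iff_exists_nnreal_btwn.1 hκ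
    have hq0 : 0 < q := by exact_mod_cast hq
    refine ⟨NNReal.sqrt q, NNReal.sqrt_pos.2 hq0, ?_⟩
    have : NNReal.sqrt q ^ 2 = q := NNReal.sq_sqrt q
    rw [← ENNReal.coe_pow, this]
    exact hqκ.le
  obtain ⟨T, hT, hTη⟩ := aux_tail _ hE (2 * (k : ℝ≥0∞) * ENNReal.ofReal (ε / 2)) (by
    have h1 : 0 < ENNReal.ofReal (ε / 2) := ENNReal.ofReal_pos.2 (by linarith)
    have h2 : (0 : ℝ≥0∞) < k := by exact_mod_cast hk
    exact ENNReal.mul_pos (mul_ne_zero two_ne_zero h2.ne') h1.ne')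
  obtain ⟨n, hn1, hn2⟩ := ((htn.eventually (eventually_ge_atTop T)).and
    (hconv.eventually (Metric.ball_mem_nhds up (half_pos hε)))).exists
  refine ⟨tn n, fun t ht => ?_⟩
  by_contra hge
  push Not at hge
  have hs0 : 0 ≤ tn n := hT.trans hn1
  have hcu : ContinuousOn u (Icc (tn n) t) := hu.mono (fun x hx => hs0.trans hx.1)
  obtain ⟨t1, t2, h1, h12, h2, hf1, hf2, hmid⟩ :=
    aux_crossing (fun r => dist (u r) up) (tn n) t (ε / 2) ε ht
      (continuous_dist.comp_continuousOn (hcu.prodMk continuousOn_const))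
      (le_of_lt hn2) (hεε.trans hge)
  have hlow : ENNReal.ofReal (ε / 2) ≤ ∫⁻ r in Ioo t1 t2, ‖g r‖ₑ := by
    have hd : ε / 2 ≤ ‖u t2 - u t1‖ := by
      rw [← dist_eq_norm]
      have := dist_triangle (u t2) (u t1) up
      linarith
    calc ENNReal.ofReal (ε / 2) ≤ ENNReal.ofReal ‖u t2 - u t1‖ := ENNReal.ofReal_le_ofReal hd
      _ = ‖u t2 - u t1‖ₑ := ofReal_norm _
      _ = ‖∫ r in Ioo t1 t2, g r‖ₑ := by
        rw [hFTC t1 (hs0.trans h1) t2 (hs0.trans (h1.trans h12)),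
          intervalIntegral.integral_of_le h12, integral_Ioc_eq_integral_Ioo]
      _ ≤ _ := enorm_integral_le_lintegral_enorm _
  have hup2 : 2 * (k : ℝ≥0∞) * (∫⁻ r in Ioo t1 t2, ‖g r‖ₑ) ≤
      ∫⁻ r in Ici T, ((‖g r‖₊ : ℝ≥0∞) ^ 2 + W (u r)) := by
    rw [← lintegral_const_mul _ hg.enorm]
    refine (setLIntegral_mono' measurableSet_Ioo (fun r hr => ?_)).trans
      (lintegral_mono_set (fun r hr => (hn1.trans h1).trans (le_of_lt hr.1)))
    refine aux_young k ‖g r‖₊ _ (hkκ.trans (hκW _ ?_))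
    obtain ⟨ha, hb⟩ := hmid r hr
    refine (Metric.le_infDist ⟨up, hup⟩).2 (fun y hy => ?_)
    by_cases hyu : y = up
    · rw [hyu]
      exact ha.le
    · have h3 := hsep y hy hyu
      have h4 := dist_triangle_left y up (u r)
      linarith
  exact absurd ((mul_le_mul_right hlow _).trans hup2) (not_le.2 hTη)
end
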